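/- In the one-relator group K presented by two generators a, b and the single relator a·b·a·b⁻¹, if v is an odd integer and u, u' are integers with u ≡ u' (mod 2), then the elements a^u · b^v and a^{u'} · b^v are conjugate in K. -/

import Mathlib

/-- The relator `a·b·a·b⁻¹` of the Klein bottle group, in the free group on
two generators. -/
def kleinRel : FreeGroup (Fin 2) :=
  FreeGroup.of 0 * FreeGroup.of 1 * FreeGroup.of 0 * (FreeGroup.of 1)⁻¹

/-- The one-relator group `⟨a,b ; abab⁻¹⟩`, the fundamental group of the
Klein bottle. -/
abbrev KleinGroup : Type := PresentedGroup ({kleinRel} : Set (FreeGroup (Fin 2)))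

/-- The image of the generator `a` in the Klein bottle group. -/
def kA : KleinGroup := PresentedGroup.of 0

/-- The image of the generator `b` in the Klein bottle group. -/
def kB : KleinGroup := PresentedGroup.of 1

/-- The defining relation of the Klein bottle group: `b` conjugates `a` to `a⁻¹`. -/
theorem semiconjBy_kB_kA : SemiconjBy kB kA kA⁻¹ := by
  have h : kA * kB * kA * kB⁻¹ = 1 :=
    PresentedGroup.one_of_mem (rels := {kleinRel}) (Set.mem_singleton kleinRel)
  rw [mul_inv_eq_one, mul_assoc] at h
  exact eq_inv_mul_of_mul_eq h

/-- If `b` conjugates `a` to `a⁻¹`, then so does every odd power of `b`. -/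
theorem SemiconjBy.zpow_left_of_odd {G : Type*} [Group G] {a b : G}
    (h : SemiconjBy b a a⁻¹) {v : ℤ} (hv : Odd v) : SemiconjBy (b ^ v) a a⁻¹ := by
  obtain ⟨k, rfl⟩ := hv
  have hsq : Commute (b * b) a := by
    have h_sq : SemiconjBy (b * b) a a := by simpa using h.inv_right.mul_left h
    exact h_sq
  rw [zpow_add_one, zpow_mul, zpow_two]
  exact SemiconjBy.mul_left (hsq.zpow_left k).inv_right h

/-- If `v` is odd and `u ≡ u' (mod 2)`, then `a^u · b^v` and `a^u' · b^v`
are conjugate in `⟨a,b ; abab⁻¹⟩`. -/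
theorem klein_odd_conj (u u' v : ℤ) (hv : Odd v) (hu : u ≡ u' [ZMOD 2]) :
    IsConj (kA ^ u * kB ^ v) (kA ^ u' * kB ^ v) := by
  obtain ⟨k, hk⟩ := hu.dvd
  obtain rfl : u' = k + u + k := by lia
  have h : kB ^ v * kA ^ (-k) = kA ^ k * kB ^ v := by
    simpa [SemiconjBy] using (semiconjBy_kB_kA.zpow_left_of_odd hv).zpow_right (-k)
  refine isConj_iff.mpr ⟨kA ^ k, ?_⟩
  rw [← zpow_neg, mul_assoc, mul_assoc, h, zpow_add, zpow_add]
  simp only [mul_assoc]
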